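/- Assume T > R > P > S, 2R > T + S, 0 ≤ γ < 1 and γ² > (T−R)/(T−P). Define Q : {C,D} × Ω × Ω → ℝ by: Q(C,(C,C),(C,C)) = R/(1−γ); Q(D,(C,C),(C,C)) = T + γR/(1−γ²) + γ²P/(1−γ²); for s2 ≠ (C,C): Q(C,(C,C),s2) = S + γR/(1−γ²) + γ²P/(1−γ²) and Q(D,(C,C),s2) = P/(1−γ²) + γR/(1−γ²); for s1 ≠ (C,C): Q(C,s1,(C,C)) = R/(1−γ²) + γP/(1−γ²) and Q(D,s1,(C,C)) = T + γP/(1−γ); for s1 ≠ (C,C) and s2 ≠ (C,C): Q(C,s1,s2) = S + γP/(1−γ) and Q(D,s1,s2) = P/(1−γ). Then Q satisfies the player-1 memory-two Bellman optimality equation against the retarded Grim strategy τ (τ(s1,s2) = C iff s2 = (C,C)), and τ is strictly greedy for Q: for all s1, s2, if s2 = (C,C) then Q(C,s1,s2) > Q(D,s1,s2), and if s2 ≠ (C,C) then Q(D,s1,s2) > Q(C,s1,s2). -/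

import Mathlib

inductive Act where
  | C : Act
  | D : Act
deriving DecidableEq

open Act

abbrev St : Type := Act × Act

/-- Player 1's payoff in the prisoner's dilemma. -/
def r1 (R S T P : ℝ) : Act → Act → ℝ
  | C, C => R
  | C, D => S
  | D, C => T
  | D, D => P

/-- Swap the roles of the two players in a state. -/
def pi' (s : St) : St := (s.2, s.1)

/-- The explicit action-value function for the retarded Grim equilibrium. -/
noncomputable def Qgrim (R S T P γ : ℝ) (σ : Act) (s1 s2 : St) : ℝ :=
  if s1 = (C, C) then
    if s2 = (C, C) then
      match σ with
      | C => R / (1 - γ)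
      | D => T + γ * R / (1 - γ ^ 2) + γ ^ 2 * P / (1 - γ ^ 2)
    else
      match σ with
      | C => S + γ * R / (1 - γ ^ 2) + γ ^ 2 * P / (1 - γ ^ 2)
      | D => P / (1 - γ ^ 2) + γ * R / (1 - γ ^ 2)
  else
    if s2 = (C, C) then
      match σ with
      | C => R / (1 - γ ^ 2) + γ * P / (1 - γ ^ 2)
      | D => T + γ * P / (1 - γ)
    else
      match σ with
      | C => S + γ * P / (1 - γ)
      | D => P / (1 - γ)

theorem Qgrim_greedy (R S T P γ : ℝ) (hPS : P > S) (hγ0 : 0 ≤ γ) (hγ1 : γ < 1)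
    (hγ2 : T - R < γ ^ 2 * (T - P)) (s1 s2 : St) :
    (s2 = (C, C) → Qgrim R S T P γ C s1 s2 > Qgrim R S T P γ D s1 s2) ∧
    (s2 ≠ (C, C) → Qgrim R S T P γ D s1 s2 > Qgrim R S T P γ C s1 s2) := by
  have h1 : 0 < 1 - γ := by linarith
  have h2 : 0 < 1 + γ := by linarith
  have hfac : 1 - γ ^ 2 = (1 - γ) * (1 + γ) := by ring
  have h3 : 0 < 1 - γ ^ 2 := hfac ▸ mul_pos h1 h2
  refine ⟨fun hs2 => ?_, fun hs2 => ?_⟩ <;> by_cases hs1 : s1 = (C, C) <;>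
    simp only [Qgrim, hs1, hs2, if_true, if_false, gt_iff_lt] <;> rw [← sub_pos]
  · have : R / (1 - γ) - (T + γ * R / (1 - γ ^ 2) + γ ^ 2 * P / (1 - γ ^ 2)) =
        (γ ^ 2 * (T - P) - (T - R)) / (1 - γ ^ 2) := by
      rw [hfac]; field_simp; ring
    rw [this]
    exact div_pos (by linarith) h3
  · have : R / (1 - γ ^ 2) + γ * P / (1 - γ ^ 2) - (T + γ * P / (1 - γ)) =
        (γ ^ 2 * (T - P) - (T - R)) / (1 - γ ^ 2) := by
      rw [hfac]; field_simp; ring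
    rw [this]
    exact div_pos (by linarith) h3
  · have : P / (1 - γ ^ 2) + γ * R / (1 - γ ^ 2) -
        (S + γ * R / (1 - γ ^ 2) + γ ^ 2 * P / (1 - γ ^ 2)) = P - S := by
      field_simp; ring
    linarith
  · have : P / (1 - γ) - (S + γ * P / (1 - γ)) = P - S := by
      field_simp; ring
    linarith

/-- the explicit `Qgrim` satisfies the player-1 memory-two Bellman optimality
equation against the retarded Grim strategy, and the retarded Grim strategy is strictly greedy
for it, whenever `γ² > (T−R)/(T−P)`. -/
theorem stmt_7 (R S T P γ : ℝ) (hTR : T > R) (hRP : R > P) (hPS : P > S)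
    (h2R : 2 * R > T + S) (hγ0 : 0 ≤ γ) (hγ1 : γ < 1)
    (hγ2 : γ ^ 2 > (T - R) / (T - P))
    (τ : St → St → Act) (hτ : ∀ s1 s2, τ s1 s2 = if s2 = (C, C) then C else D) :
    (∀ σ s1 s2, Qgrim R S T P γ σ s1 s2 =
      r1 R S T P σ (τ s1 s2) +
        γ * max (Qgrim R S T P γ C (σ, τ s1 s2) s1)
          (Qgrim R S T P γ D (σ, τ s1 s2) s1)) ∧
    (∀ s1 s2 : St,
      (s2 = (C, C) → Qgrim R S T P γ C s1 s2 > Qgrim R S T P γ D s1 s2) ∧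
      (s2 ≠ (C, C) → Qgrim R S T P γ D s1 s2 > Qgrim R S T P γ C s1 s2)) := by
  have hgap : T - R < γ ^ 2 * (T - P) := (div_lt_iff₀ (by linarith)).mp hγ2
  have hgreedy := Qgrim_greedy R S T P γ hPS hγ0 hγ1 hgap
  refine ⟨fun σ s1 s2 => ?_, hgreedy⟩
  have h1 : 1 - γ ≠ 0 := by linarith
  have h2 : 1 + γ ≠ 0 := by linarith
  have hfac : 1 - γ ^ 2 = (1 - γ) * (1 + γ) := by ring
  by_cases hs1 : s1 = (C, C)
  · rw [max_eq_left ((hgreedy _ s1).1 hs1).le, hτ]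
    by_cases hs2 : s2 = (C, C) <;> cases σ <;>
      simp [Qgrim, r1, hs1, hs2, hfac] <;> field_simp <;> ring
  · rw [max_eq_right ((hgreedy _ s1).2 hs1).le, hτ]
    by_cases hs2 : s2 = (C, C) <;> cases σ <;>
      simp [Qgrim, r1, hs1, hs2, hfac] <;> field_simp <;> ring
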